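/- Let L be a countable language possessing at least one closed term, t_1, t_2, … an enumeration of all closed L-terms, μ a Gaifman probability on sentences, and φ an L-formula with exactly one free variable x such that μ(∀x. φ) > 0. Then lim_{n→∞} μ(∀x. φ | ⋀_{i=1}^n φ[x := t_i]) = 1. (The conditional probabilities are well defined since μ(⋀_{i=1}^n φ[x := t_i]) ≥ μ(∀x. φ) > 0.) -/

import Mathlib

open FirstOrder Language Filter

/-- A sentence is valid if it is satisfied by every nonempty structure. -/
def IsValidSentence (L : FirstOrder.Language) (φ : L.Sentence) : Prop :=
  ∀ (M : Type) [Nonempty M] [L.Structure M], M ⊨ φ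

/-- A probability on sentences. -/
structure SentenceProb (L : FirstOrder.Language) where
  toFun : L.Sentence → ℝ
  nonneg : ∀ φ, 0 ≤ toFun φ
  valid_one : ∀ φ, IsValidSentence L φ → toFun φ = 1
  add : ∀ φ ψ, IsValidSentence L (∼(φ ⊓ ψ)) → toFun (φ ⊔ ψ) = toFun φ + toFun ψ

/-- Substitute the closed term `t` for the unique (bound) variable of `φ`,
yielding the sentence `φ[x := t]`. -/
def instantiate {L : FirstOrder.Language} (φ : L.BoundedFormula Empty 1)
    (t : L.Term Empty) : L.Sentence :=
  φ.toFormula.subst (fun _ => t)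

/-- The disjunction `φ[x := t] ∨ φ[x := s₁] ∨ ⋯ ∨ φ[x := s_m]` over the
nonempty finite collection of closed terms `t :: l`. -/
def disjOf {L : FirstOrder.Language} (φ : L.BoundedFormula Empty 1)
    (t : L.Term Empty) (l : List (L.Term Empty)) : L.Sentence :=
  l.foldl (fun χ s => χ ⊔ instantiate φ s) (instantiate φ t)

/-- The conjunction `φ[x := t] ∧ φ[x := s₁] ∧ ⋯ ∧ φ[x := s_m]` over the
nonempty finite collection of closed terms `t :: l`. -/
def conjOf {L : FirstOrder.Language} (φ : L.BoundedFormula Empty 1)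
    (t : L.Term Empty) (l : List (L.Term Empty)) : L.Sentence :=
  l.foldl (fun χ s => χ ⊓ instantiate φ s) (instantiate φ t)

/-- `⋁_{i=0}^n φ[x := t_i]`. -/
def disjUpTo {L : FirstOrder.Language} (φ : L.BoundedFormula Empty 1)
    (t : ℕ → L.Term Empty) : ℕ → L.Sentence
  | 0 => instantiate φ (t 0)
  | n + 1 => disjUpTo φ t n ⊔ instantiate φ (t (n + 1))

/-- `⋀_{i=0}^n φ[x := t_i]`. -/
def conjUpTo {L : FirstOrder.Language} (φ : L.BoundedFormula Empty 1)
    (t : ℕ → L.Term Empty) : ℕ → L.Sentence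
  | 0 => instantiate φ (t 0)
  | n + 1 => conjUpTo φ t n ⊓ instantiate φ (t (n + 1))

/-- A probability on sentences is Gaifman (w.r.t. an enumeration `t` of all
closed terms) if `μ(∀x.φ) = lim_n μ(⋀_{i≤n} φ[x := t_i])` for all `φ`. -/
def IsGaifman {L : FirstOrder.Language} (μ : SentenceProb L)
    (t : ℕ → L.Term Empty) : Prop :=
  ∀ ψ : L.BoundedFormula Empty 1,
    Tendsto (fun n => μ.toFun (conjUpTo ψ t n)) atTop (nhds (μ.toFun (∀'ψ)))

theorem SentenceProb.congr {L : FirstOrder.Language} (μ : SentenceProb L) {φ ψ : L.Sentence}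
    (h : ∀ (M : Type) [Nonempty M] [L.Structure M], M ⊨ φ ↔ M ⊨ ψ) :
    μ.toFun φ = μ.toFun ψ := by
  have key : ∀ χ : L.Sentence,
      (∀ (M : Type) [Nonempty M] [L.Structure M], M ⊨ χ ↔ M ⊨ ψ) →
      μ.toFun χ + μ.toFun (∼ψ) = 1 := by
    intro χ hχ
    rw [← μ.add]
    · apply μ.valid_one
      intro M _ _
      have := hχ M
      simp only [Sentence.Realize, Formula.realize_sup, Formula.realize_not] at this ⊢
      tauto
    · intro M _ _
      have := hχ M
      simp only [Sentence.Realize, Formula.realize_inf, Formula.realize_not] at this ⊢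
      tauto
  linarith [key φ h, key ψ fun _ _ _ => Iff.rfl]

theorem realize_instantiate_of_realize_all {L : FirstOrder.Language} {M : Type} [L.Structure M]
    {φ : L.BoundedFormula Empty 1} (h : M ⊨ (∀'φ : L.Sentence)) (s : L.Term Empty) :
    M ⊨ instantiate φ s := by
  simp only [Sentence.Realize, Formula.Realize, BoundedFormula.realize_all] at h
  have h' := h (s.realize default)
  simp only [instantiate, Sentence.Realize, Formula.Realize, BoundedFormula.realize_subst]
  refine (BoundedFormula.realize_toFormula φ _).2 ?_
  convert h' using 1
  ext i
  fin_cases i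
  rfl

theorem realize_conjUpTo_of_realize_all {L : FirstOrder.Language} {M : Type} [L.Structure M]
    {φ : L.BoundedFormula Empty 1} (h : M ⊨ (∀'φ : L.Sentence)) (t : ℕ → L.Term Empty) (n : ℕ) :
    M ⊨ conjUpTo φ t n := by
  induction n with
  | zero => exact realize_instantiate_of_realize_all h _
  | succ n ih => exact Formula.realize_inf.2 ⟨ih, realize_instantiate_of_realize_all h _⟩

theorem gaifman_learns_universal_hypotheses {L : FirstOrder.Language}
    [Countable L.Symbols] (μ : SentenceProb L)
    (t : ℕ → L.Term Empty) (ht : Function.Surjective t)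
    (hG : IsGaifman μ t)
    (φ : L.BoundedFormula Empty 1) (hpos : 0 < μ.toFun (∀'φ)) :
    Tendsto (fun n => μ.toFun ((∀'φ) ⊓ conjUpTo φ t n) / μ.toFun (conjUpTo φ t n))
      atTop (nhds 1) := by
  have h : ∀ n, μ.toFun ((∀'φ) ⊓ conjUpTo φ t n) = μ.toFun (∀'φ) := fun n =>
    μ.congr fun M _ _ =>
      ⟨fun hM => (Formula.realize_inf.1 hM).1,
        fun hM => Formula.realize_inf.2 ⟨hM, realize_conjUpTo_of_realize_all hM t n⟩⟩
  simp only [h]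
  rw [← div_self hpos.ne']
  exact tendsto_const_nhds.div (hG φ) hpos.ne'
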